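/- arXiv:1705.05916 — 9 statements merged into one kernel-verified Lean document; each statement's English description precedes it below -/
import Mathlib

section
/- Let Σ be a symmetric positive semidefinite real n×n matrix, let σ_i = √(Σ_{ii}), let Ω ≥ 0, let d ∈ ℝ, and let μ ∈ ℝ^n satisfy μ_i ≥ Ω σ_i for all i. Then the set function q : {0,1}^n → ℝ defined by q(x) = Ω² x'Σx − (μ'x − d)² is submodular. -/
theorem sig_le (n : ℕ) (Sig : Matrix (Fin n) (Fin n) ℝ) (hpsd : Sig.PosSemidef)
    (i j : Fin n) : Sig i j ≤ Real.sqrt (Sig i i) * Real.sqrt (Sig j j) := by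
  have h := (hpsd.submatrix ![i, j]).det_nonneg
  rw [Matrix.det_fin_two] at h
  have hs : Sig j i = Sig i j := by simpa using hpsd.isHermitian.apply i j
  simp [hs] at h
  rw [← Real.sqrt_mul (hpsd.diag_nonneg)]
  apply Real.le_sqrt_of_sq_le
  nlinarith

theorem q_marg (n : ℕ) (Sig : Matrix (Fin n) (Fin n) ℝ) (hpsd : Sig.PosSemidef)
    (Ω d : ℝ) (μ : Fin n → ℝ) (q : Finset (Fin n) → ℝ)
    (hq : ∀ S : Finset (Fin n),
      q S = Ω ^ 2 * (∑ i ∈ S, ∑ j ∈ S, Sig i j) - ((∑ i ∈ S, μ i) - d) ^ 2)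
    (S : Finset (Fin n)) (i : Fin n) (hi : i ∉ S) :
    q (insert i S) - q S = Ω ^ 2 * Sig i i - μ i ^ 2 + 2 * μ i * d
      + 2 * ∑ j ∈ S, (Ω ^ 2 * Sig i j - μ i * μ j) := by
  have hs : ∀ j, Sig j i = Sig i j := fun j => by simpa using hpsd.isHermitian.apply i j
  rw [hq, hq, Finset.sum_insert hi, Finset.sum_insert hi, Finset.sum_insert hi,
    Finset.sum_sub_distrib, ← Finset.mul_sum, ← Finset.mul_sum]
  simp only [Finset.sum_insert hi, Finset.sum_add_distrib, hs]
  ring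

/-- If `Σ` is a symmetric positive semidefinite matrix, `σ_i = √(Σ_{ii})`,
`Ω ≥ 0`, and `μ_i ≥ Ω σ_i` for all `i`, then the set function
`q(x) = Ω² xᵀΣx − (μᵀx − d)²` on binary vectors (subsets) is submodular. -/
theorem q_submodular
    (n : ℕ) (Sig : Matrix (Fin n) (Fin n) ℝ) (hpsd : Sig.PosSemidef)
    (Ω : ℝ) (hΩ : 0 ≤ Ω) (d : ℝ) (μ : Fin n → ℝ)
    (hμ : ∀ i : Fin n, Ω * Real.sqrt (Sig i i) ≤ μ i)
    (q : Finset (Fin n) → ℝ)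
    (hq : ∀ S : Finset (Fin n),
      q S = Ω ^ 2 * (∑ i ∈ S, ∑ j ∈ S, Sig i j) - ((∑ i ∈ S, μ i) - d) ^ 2) :
    ∀ (S T : Finset (Fin n)) (i : Fin n), S ⊆ T → i ∉ T →
      q (insert i T) - q T ≤ q (insert i S) - q S := by
  intro S T i hST hi
  rw [q_marg n Sig hpsd Ω d μ q hq T i hi,
    q_marg n Sig hpsd Ω d μ q hq S i (fun h => hi (hST h)), ← Finset.sum_sdiff hST]
  have : ∑ j ∈ T \ S, (Ω ^ 2 * Sig i j - μ i * μ j) ≤ 0 := by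
    apply Finset.sum_nonpos
    intro j _
    have h1 := mul_le_mul_of_nonneg_left (sig_le n Sig hpsd i j) (sq_nonneg Ω)
    have h2 := mul_le_mul (hμ i) (hμ j) (by positivity)
      (le_trans (by positivity) (hμ i))
    nlinarith
  linarith
end

section
/- Let Ω ≥ 0, let μ ∈ ℝ^n, and let σ_1², …, σ_n² ≥ 0. Then the set function f : {0,1}^n → ℝ defined by f(x) = ∑_{i=1}^n μ_i x_i − Ω √(∑_{i=1}^n σ_i² x_i) is supermodular. -/
theorem sqrt_aux (a b c : ℝ) (ha : 0 ≤ a) (hab : a ≤ b) (hc : 0 ≤ c) :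
    Real.sqrt (c + b) - Real.sqrt b ≤ Real.sqrt (c + a) - Real.sqrt a := by
  have h1 := Real.sq_sqrt ha
  have h2 := Real.sq_sqrt (ha.trans hab)
  have h3 := Real.sq_sqrt (add_nonneg hc ha)
  have h4 := Real.sq_sqrt (add_nonneg hc (ha.trans hab))
  have h5 : Real.sqrt a ≤ Real.sqrt b := Real.sqrt_le_sqrt hab
  have h6 : Real.sqrt (c + a) ≤ Real.sqrt (c + b) := Real.sqrt_le_sqrt (by linarith)
  have h7 : Real.sqrt a ≤ Real.sqrt (c + a) := Real.sqrt_le_sqrt (by linarith)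
  have h8 := Real.sqrt_nonneg b
  generalize Real.sqrt a = p at *
  generalize Real.sqrt b = q at *
  generalize Real.sqrt (c + a) = r at *
  generalize Real.sqrt (c + b) = s at *
  by_contra! h
  have e1 : 0 < (s - q - (r - p)) * (s + q) := mul_pos (by linarith) (by linarith)
  have e2 : 0 ≤ (r - p) * (s + q - (r + p)) := mul_nonneg (by linarith) (by linarith)
  nlinarith

/-- For `Ω ≥ 0`, `μ ∈ ℝⁿ` and variances `σ_i² ≥ 0`, the set function
`f(x) = ∑ μ_i x_i − Ω √(∑ σ_i² x_i)` on binary vectors (subsets) is supermodular. -/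
theorem f_supermodular
    (n : ℕ) (Ω : ℝ) (hΩ : 0 ≤ Ω) (μ : Fin n → ℝ) (σsq : Fin n → ℝ)
    (hσ : ∀ i : Fin n, 0 ≤ σsq i)
    (f : Finset (Fin n) → ℝ)
    (hf : ∀ S : Finset (Fin n),
      f S = (∑ i ∈ S, μ i) - Ω * Real.sqrt (∑ i ∈ S, σsq i)) :
    ∀ (S T : Finset (Fin n)) (i : Fin n), S ⊆ T → i ∉ T →
      f (insert i S) - f S ≤ f (insert i T) - f T := by
  intro S T i hST hiT
  have hiS : i ∉ S := fun h => hiT (hST h)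
  simp only [hf, Finset.sum_insert hiT, Finset.sum_insert hiS]
  have key := mul_le_mul_of_nonneg_left (sqrt_aux (∑ j ∈ S, σsq j) (∑ j ∈ T, σsq j) (σsq i)
    (Finset.sum_nonneg fun j _ => hσ j)
    (Finset.sum_le_sum_of_subset_of_nonneg hST fun j _ _ => hσ j) (hσ i)) hΩ
  linarith
end

section
/- Let Ω ≥ 0, let σ_1, …, σ_n ≥ 0, and let μ ∈ ℝ^n satisfy μ_i ≥ Ω σ_i for all i. Then the set function f(S) = ∑_{i∈S} μ_i − Ω √(∑_{i∈S} σ_i²) on subsets S of {1,…,n} is non-decreasing: f(S) ≤ f(T) whenever S ⊆ T ⊆ {1,…,n}. -/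
/-- For `Ω ≥ 0`, `σ_i ≥ 0` and `μ_i ≥ Ω σ_i` for all `i`, the set function
`f(S) = ∑_{i∈S} μ_i − Ω √(∑_{i∈S} σ_i²)` is non-decreasing. -/
theorem f_monotone
    (n : ℕ) (Ω : ℝ) (hΩ : 0 ≤ Ω) (σ : Fin n → ℝ) (hσ : ∀ i : Fin n, 0 ≤ σ i)
    (μ : Fin n → ℝ) (hμ : ∀ i : Fin n, Ω * σ i ≤ μ i)
    (f : Finset (Fin n) → ℝ)
    (hf : ∀ S : Finset (Fin n),
      f S = (∑ i ∈ S, μ i) - Ω * Real.sqrt (∑ i ∈ S, (σ i) ^ 2)) :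
    ∀ (S T : Finset (Fin n)), S ⊆ T → f S ≤ f T := by
  intro S T hST
  rw [hf, hf, ← Finset.sum_sdiff hST, ← Finset.sum_sdiff (f := fun i => σ i ^ 2) hST]
  have hs0 : 0 ≤ ∑ i ∈ T \ S, σ i := Finset.sum_nonneg fun i _ => hσ i
  have hA0 : 0 ≤ ∑ i ∈ S, σ i ^ 2 := Finset.sum_nonneg fun i _ => sq_nonneg _
  have hB : ∑ i ∈ T \ S, σ i ^ 2 ≤ (∑ i ∈ T \ S, σ i) ^ 2 :=
    Finset.sum_sq_le_sq_sum_of_nonneg fun i _ => hσ i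
  have hsum : Ω * ∑ i ∈ T \ S, σ i ≤ ∑ i ∈ T \ S, μ i := by
    rw [Finset.mul_sum]
    exact Finset.sum_le_sum fun i _ => hμ i
  have hr := Real.sqrt_nonneg (∑ i ∈ S, σ i ^ 2)
  have hsq := Real.sq_sqrt hA0
  have hle : Real.sqrt (∑ i ∈ T \ S, σ i ^ 2 + ∑ i ∈ S, σ i ^ 2)
      ≤ Real.sqrt (∑ i ∈ S, σ i ^ 2) + ∑ i ∈ T \ S, σ i := by
    apply Real.sqrt_le_iff.mpr
    refine ⟨by positivity, ?_⟩
    nlinarith [mul_nonneg hr hs0]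
  have := mul_le_mul_of_nonneg_left hle hΩ
  linarith
end

section
/- Let g : 2^N → ℝ be a submodular set function on a finite ground set N with g(∅) = 0, and let i_1, …, i_n be an enumeration (permutation) of N with S_j = {i_1, …, i_j} (and S_0 = ∅). Define v ∈ ℝ^N by v_{i_j} = g(S_j) − g(S_{j−1}) for j = 1, …, n. Then v belongs to the extended polymatroid EP_g, and moreover ∑_{i ∈ S_j} v_i = g(S_j) for every j = 0, 1, …, n. -/
/-- Edmonds' greedy vertices: for a submodular `g` with `g(∅) = 0` and a
permutation `π` of the ground set, with `S_j` the set of the first `j` elements of `π`,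
the vector `v` with `v_{i_j} = g(S_j) − g(S_{j−1})` belongs to the extended polymatroid
`EP_g` and satisfies `v(S_j) = g(S_j)` for every `j`. -/
theorem greedy_vertex_mem_extended_polymatroid
    (n : ℕ) (g : Finset (Fin n) → ℝ)
    (hsub : ∀ (S T : Finset (Fin n)) (i : Fin n), S ⊆ T → i ∉ T →
      g (insert i T) - g T ≤ g (insert i S) - g S)
    (h0 : g ∅ = 0)
    (π : Equiv.Perm (Fin n))
    (Sj : ℕ → Finset (Fin n))
    (hSj : ∀ j : ℕ, Sj j = Finset.univ.filter (fun i : Fin n => (π.symm i : ℕ) < j))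
    (v : Fin n → ℝ)
    (hv : ∀ i : Fin n, v i = g (Sj ((π.symm i : ℕ) + 1)) - g (Sj (π.symm i : ℕ))) :
    (∀ S : Finset (Fin n), ∑ i ∈ S, v i ≤ g S) ∧
      (∀ j : ℕ, j ≤ n → ∑ i ∈ Sj j, v i = g (Sj j)) := by
  have hm : ∀ j i, i ∈ Sj j ↔ (π.symm i : ℕ) < j := by
    intro j i
    rw [hSj]; simp
  have hz : Sj 0 = ∅ := by
    ext i; simp [hm]
  have hs : ∀ j (hj : j < n), Sj (j + 1) = insert (π ⟨j, hj⟩) (Sj j) := by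
    intro j hj
    ext i
    rw [Finset.mem_insert, hm, hm, ← Equiv.symm_apply_eq, Fin.ext_iff]
    simp only
    omega
  have hn : ∀ j (hj : j < n), π ⟨j, hj⟩ ∉ Sj j := by
    intro j hj
    simp [hm]
  have hvj : ∀ j (hj : j < n), v (π ⟨j, hj⟩) = g (insert (π ⟨j, hj⟩) (Sj j)) - g (Sj j) := by
    intro j hj
    rw [hv, ← hs j hj]; simp
  refine ⟨?_, ?_⟩
  · intro S
    have key : ∀ j, j ≤ n → ∑ i ∈ S ∩ Sj j, v i ≤ g (S ∩ Sj j) := by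
      intro j
      induction j with
      | zero => intro _; simp [hz, h0]
      | succ j ih =>
        intro hj
        have hj' : j < n := hj
        have ih := ih hj'.le
        rw [hs j hj']
        by_cases hS : π ⟨j, hj'⟩ ∈ S
        · rw [Finset.inter_insert_of_mem hS, Finset.sum_insert
            (fun h => hn j hj' (Finset.mem_inter.1 h).2), hvj j hj']
          have := hsub (S ∩ Sj j) (Sj j) (π ⟨j, hj'⟩) Finset.inter_subset_right (hn j hj')
          linarith
        · rw [Finset.inter_insert_of_notMem hS]
          exact ih
    have hu : S ∩ Sj n = S := by
      ext i; simp [hm]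
    have := key n le_rfl
    rwa [hu] at this
  · intro j
    induction j with
    | zero => intro _; simp [hz, h0]
    | succ j ih =>
      intro hj
      have hj' : j < n := hj
      rw [hs j hj', Finset.sum_insert (hn j hj'), hvj j hj', ih hj'.le]
      ring
end

section
/- Let g : 2^N → ℝ be a submodular set function on a finite ground set N with g(∅) = 0. Then for every S ⊆ N, g(S) = max { ∑_{i∈S} v_i : v ∈ EP_g }, and the maximum is attained: there exists v ∈ EP_g with ∑_{i∈S} v_i = g(S), while ∑_{i∈S} v_i ≤ g(S) for every v ∈ EP_g. -/
theorem ep_step (n : ℕ) (g : Finset (Fin n) → ℝ)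
    (hsub : ∀ (S T : Finset (Fin n)) (i : Fin n), S ⊆ T → i ∉ T →
      g (insert i T) - g T ≤ g (insert i S) - g S)
    (A : Finset (Fin n)) (a : Fin n) (ha : a ∉ A) (v : Fin n → ℝ)
    (hv : ∀ T, T ⊆ A → ∑ i ∈ T, v i ≤ g T) (hA : ∑ i ∈ A, v i = g A) :
    ∃ w : Fin n → ℝ, (∀ T, T ⊆ insert a A → ∑ i ∈ T, w i ≤ g T) ∧
      ∑ i ∈ insert a A, w i = g (insert a A) ∧
      ∀ T, a ∉ T → ∑ i ∈ T, w i = ∑ i ∈ T, v i := by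
  have key : ∀ T : Finset (Fin n), a ∉ T →
      ∑ i ∈ T, Function.update v a (g (insert a A) - g A) i = ∑ i ∈ T, v i := by
    intro T hT
    apply Finset.sum_congr rfl
    intro i hi
    have hne : i ≠ a := by
      rintro rfl
      exact hT hi
    exact Function.update_of_ne hne _ _
  refine ⟨Function.update v a (g (insert a A) - g A), ?_, ?_, key⟩
  · intro T hT
    by_cases haT : a ∈ T
    · have h1 : T.erase a ⊆ A := Finset.subset_insert_iff.mp hT
      have h2 := hsub _ _ a h1 ha
      have h3 := hv _ h1
      rw [← Finset.add_sum_erase T _ haT, key _ (Finset.notMem_erase a T),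
        Function.update_self]
      rw [Finset.insert_erase haT] at h2
      linarith
    · rw [key T haT]
      exact hv T ((Finset.subset_insert_iff_of_notMem haT).mp hT)
  · rw [Finset.sum_insert ha, key A ha, Function.update_self, hA]
    ring

/-- For a submodular `g` with `g(∅) = 0` and any `S ⊆ N`,
`g(S) = max { v(S) : v ∈ EP_g }`, the maximum being attained. -/
theorem submodular_eq_max_over_extended_polymatroid
    (n : ℕ) (g : Finset (Fin n) → ℝ)
    (hsub : ∀ (S T : Finset (Fin n)) (i : Fin n), S ⊆ T → i ∉ T →
      g (insert i T) - g T ≤ g (insert i S) - g S)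
    (h0 : g ∅ = 0) :
    ∀ S : Finset (Fin n),
      IsGreatest ((fun v : Fin n → ℝ => ∑ i ∈ S, v i) ''
        {v : Fin n → ℝ | ∀ T : Finset (Fin n), ∑ i ∈ T, v i ≤ g T}) (g S) := by
  intro S
  have h1 : ∀ A : Finset (Fin n), ∃ v : Fin n → ℝ,
      (∀ T, T ⊆ A → ∑ i ∈ T, v i ≤ g T) ∧ ∑ i ∈ A, v i = g A := by
    intro A
    induction A using Finset.induction_on with
    | empty =>
      refine ⟨0, ?_, by simp [h0]⟩
      intro T hT
      rw [Finset.subset_empty.mp hT]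
      simp [h0]
    | insert a A ha ih =>
      obtain ⟨v, hv, hA⟩ := ih
      obtain ⟨w, hw, hwA, -⟩ := ep_step n g hsub A a ha v hv hA
      exact ⟨w, hw, hwA⟩
  have h2 : ∀ B : Finset (Fin n), ∃ v : Fin n → ℝ,
      (∀ T, T ⊆ B ∪ S → ∑ i ∈ T, v i ≤ g T) ∧ ∑ i ∈ B ∪ S, v i = g (B ∪ S) ∧
        ∑ i ∈ S, v i = g S := by
    intro B
    induction B using Finset.induction_on with
    | empty =>
      obtain ⟨v, hv, hS⟩ := h1 S
      exact ⟨v, by simpa using hv, by simpa using hS, hS⟩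
    | insert a B _ ih =>
      obtain ⟨v, hv, hB, hS⟩ := ih
      rw [Finset.insert_union]
      by_cases ha : a ∈ B ∪ S
      · rw [Finset.insert_eq_of_mem ha]
        exact ⟨v, hv, hB, hS⟩
      · obtain ⟨w, hw, hwA, hk⟩ := ep_step n g hsub _ a ha v hv hB
        refine ⟨w, hw, hwA, ?_⟩
        rw [hk S (fun h => ha (Finset.mem_union_right _ h)), hS]
  constructor
  · obtain ⟨v, hv, -, hS⟩ := h2 Finset.univ
    exact ⟨v, fun T => hv T (fun x _ => Finset.mem_union_left _ (Finset.mem_univ x)), hS⟩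
  · rintro _ ⟨v, hv, rfl⟩
    exact hv S
end

section
/- Let g : 2^N → ℝ be a submodular set function on a finite ground set N with g(∅) = 0, and let γ ∈ ℝ. Then the discrete lower level set K_g = {x ∈ {0,1}^N : g(x) ≤ γ} satisfies K_g = {x ∈ {0,1}^N : ∑_{i∈N} v_i x_i ≤ γ for all v ∈ EP_g}; that is, a binary vector x satisfies g(x) ≤ γ if and only if it satisfies the linear knapsack inequality v'x ≤ γ for every point v of the extended polymatroid EP_g. -/
theorem ep_extend_aux (n : ℕ) (g : Finset (Fin n) → ℝ)
    (hsub : ∀ (S T : Finset (Fin n)) (i : Fin n), S ⊆ T → i ∉ T →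
      g (insert i T) - g T ≤ g (insert i S) - g S)
    (A : Finset (Fin n)) (i : Fin n) (hi : i ∉ A) (v : Fin n → ℝ)
    (hv : ∀ T ⊆ A, ∑ j ∈ T, v j ≤ g T) :
    ∃ w : Fin n → ℝ, (∀ T ⊆ insert i A, ∑ j ∈ T, w j ≤ g T) ∧
      (∀ T ⊆ A, ∑ j ∈ T, w j = ∑ j ∈ T, v j) ∧ w i = g (insert i A) - g A := by
  have key : ∀ T : Finset (Fin n), i ∉ T →
      ∑ j ∈ T, Function.update v i (g (insert i A) - g A) j = ∑ j ∈ T, v j := by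
    intro T hT
    refine Finset.sum_congr rfl fun j hj => ?_
    rw [Function.update_of_ne]
    rintro rfl
    exact hT hj
  refine ⟨Function.update v i (g (insert i A) - g A), ?_, ?_, by simp⟩
  · intro T hT
    by_cases hiT : i ∈ T
    · have hsubA : T.erase i ⊆ A := Finset.subset_insert_iff.mp hT
      have h1 := hsub (T.erase i) A i hsubA hi
      have h2 := hv _ hsubA
      have h3 := key (T.erase i) (Finset.notMem_erase i T)
      rw [Finset.insert_erase hiT] at h1
      rw [← Finset.add_sum_erase _ _ hiT, h3, Function.update_self]
      linarith
    · rw [key T hiT]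
      exact hv T ((Finset.subset_insert_iff_of_notMem hiT).mp hT)
  · intro T hT
    exact key T fun h => hi (hT h)

/-- For a submodular `g` with `g(∅) = 0` and `γ ∈ ℝ`, a binary vector
(identified with its support `S`) satisfies `g(x) ≤ γ` iff it satisfies the knapsack
inequality `vᵀx ≤ γ` for every point `v` of the extended polymatroid `EP_g`. -/
theorem lower_level_set_eq_intersection_knapsacks
    (n : ℕ) (g : Finset (Fin n) → ℝ)
    (hsub : ∀ (S T : Finset (Fin n)) (i : Fin n), S ⊆ T → i ∉ T →
      g (insert i T) - g T ≤ g (insert i S) - g S)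
    (h0 : g ∅ = 0) (γ : ℝ) :
    ∀ S : Finset (Fin n),
      g S ≤ γ ↔
        ∀ v : Fin n → ℝ, (∀ T : Finset (Fin n), ∑ i ∈ T, v i ≤ g T) →
          ∑ i ∈ S, v i ≤ γ := by
  intro S
  refine ⟨fun h v hv => (hv S).trans h, fun h => ?_⟩
  have step1 : ∃ v : Fin n → ℝ, (∀ T ⊆ S, ∑ j ∈ T, v j ≤ g T) ∧ ∑ j ∈ S, v j = g S := by
    clear h
    induction S using Finset.induction_on with
    | empty =>
      refine ⟨0, fun T hT => ?_, by simp [h0]⟩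
      rw [Finset.subset_empty.mp hT]
      simp [h0]
    | insert i A hi ih =>
      obtain ⟨v, hv, hA⟩ := ih
      obtain ⟨w, hw, hw2, hw3⟩ := ep_extend_aux n g hsub A i hi v hv
      refine ⟨w, hw, ?_⟩
      rw [Finset.sum_insert hi, hw2 A subset_rfl, hw3, hA]
      ring
  have step2 : ∀ U : Finset (Fin n), ∃ v : Fin n → ℝ,
      (∀ T ⊆ U ∪ S, ∑ j ∈ T, v j ≤ g T) ∧ ∑ j ∈ S, v j = g S := by
    intro U
    induction U using Finset.induction_on with
    | empty => simpa using step1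
    | insert i A _ ih =>
      obtain ⟨v, hv, hA⟩ := ih
      rw [Finset.insert_union]
      by_cases hi : i ∈ A ∪ S
      · rw [Finset.insert_eq_of_mem hi]
        exact ⟨v, hv, hA⟩
      · obtain ⟨w, hw, hw2, hw3⟩ := ep_extend_aux n g hsub _ i hi v hv
        exact ⟨w, hw, (hw2 S Finset.subset_union_right).trans hA⟩
  obtain ⟨v, hv, hS⟩ := step2 Finset.univ
  rw [← hS]
  exact h v fun T => hv T fun x _ => by simp
end

section
/- Let g : 2^N → ℝ be a submodular set function on a finite ground set N with g(∅) = 0, and let B_g = {(x, z) ∈ {0,1}^N × ℝ : g(x) ≤ z} be the discrete epigraph of g. Then the convex hull of B_g (as a subset of ℝ^N × ℝ) equals {(x, z) ∈ ℝ^N × ℝ : 0 ≤ x_i ≤ 1 for all i ∈ N, and ∑_{i∈N} v_i x_i ≤ z for all v ∈ EP_g}. -/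
open scoped Classical

lemma abel_aux (y f : ℕ → ℝ) (m : ℕ) :
    ∑ k ∈ Finset.range (m+1), (y k - y (k+1)) * f k =
      y 0 * f 0 - y (m+1) * f m + ∑ k ∈ Finset.range m, y (k+1) * (f (k+1) - f k) := by
  induction m with
  | zero => simp; ring
  | succ m ih => rw [Finset.sum_range_succ, ih, Finset.sum_range_succ _ m]; ring

lemma hull_aux (n : ℕ) (g : Finset (Fin n) → ℝ)
    (hsub : ∀ (S T : Finset (Fin n)) (i : Fin n), S ⊆ T → i ∉ T →
      g (insert i T) - g T ≤ g (insert i S) - g S)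
    (h0 : g ∅ = 0) (x : Fin n → ℝ) (z : ℝ) (hx : ∀ i, 0 ≤ x i ∧ x i ≤ 1)
    (hv : ∀ v : Fin n → ℝ, (∀ S : Finset (Fin n), ∑ i ∈ S, v i ≤ g S) →
          ∑ i : Fin n, v i * x i ≤ z) :
    (x, z) ∈ convexHull ℝ
        {p : (Fin n → ℝ) × ℝ | (∀ i : Fin n, p.1 i = 0 ∨ p.1 i = 1) ∧
          g (Finset.univ.filter fun i : Fin n => p.1 i = 1) ≤ p.2} := by
  obtain ⟨σ, hσ⟩ : ∃ σ : Equiv.Perm (Fin n), Antitone (x ∘ σ) := by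
    refine ⟨Tuple.sort (fun i => - x i), ?_⟩
    have := Tuple.monotone_sort (fun i => - x i)
    intro a b hab
    have := this hab
    simp only [Function.comp] at this ⊢
    linarith
  let S : ℕ → Finset (Fin n) := fun k => Finset.univ.filter fun i => (σ.symm i : ℕ) < k
  have memS : ∀ k i, i ∈ S k ↔ (σ.symm i : ℕ) < k := by intro k i; simp [S]
  have hS0 : S 0 = ∅ := by ext i; simp [memS]
  have hSn : S n = Finset.univ := by ext i; simp [memS]
  have hSs : ∀ k (h : k < n), S (k+1) = insert (σ ⟨k, h⟩) (S k) := by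
    intro k h
    ext i
    rw [Finset.mem_insert, memS, memS, ← Equiv.symm_apply_eq, Fin.ext_iff]
    simp only
    omega
  let v : Fin n → ℝ := fun i => g (S ((σ.symm i : ℕ) + 1)) - g (S (σ.symm i : ℕ))
  have hvEP : ∀ T : Finset (Fin n), ∑ i ∈ T, v i ≤ g T := by
    intro T
    have key : ∀ k, k ≤ n → ∑ i ∈ T ∩ S k, v i ≤ g (T ∩ S k) := by
      intro k
      induction k with
      | zero => intro _; simp [hS0, h0]
      | succ k ih =>
        intro hk
        have ih := ih (by omega)
        have hk' : k < n := hk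
        have hni : σ ⟨k, hk'⟩ ∉ S k := by simp [memS]
        by_cases hT : σ ⟨k, hk'⟩ ∈ T
        · have e : T ∩ S (k+1) = insert (σ ⟨k, hk'⟩) (T ∩ S k) := by
            rw [hSs k hk', Finset.inter_insert_of_mem hT]
          have hni' : σ ⟨k, hk'⟩ ∉ T ∩ S k := fun h => hni (Finset.mem_inter.1 h).2
          rw [e, Finset.sum_insert hni']
          have h1 := hsub (T ∩ S k) (S k) (σ ⟨k, hk'⟩) Finset.inter_subset_right hni
          have h2 : v (σ ⟨k, hk'⟩) = g (insert (σ ⟨k, hk'⟩) (S k)) - g (S k) := by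
            simp only [v, Equiv.symm_apply_apply, ← hSs k hk']
          linarith
        · rw [hSs k hk', Finset.inter_insert_of_notMem hT]
          exact ih
    have := key n le_rfl
    rwa [hSn, Finset.inter_univ] at this
  let y : ℕ → ℝ := fun k => match k with
    | 0 => 1
    | k+1 => if h : k < n then x (σ ⟨k, h⟩) else 0
  have y0 : y 0 = 1 := rfl
  have ys : ∀ k (h : k < n), y (k+1) = x (σ ⟨k, h⟩) := fun k h => by simp [y, h]
  have yn : y (n+1) = 0 := by simp [y]
  have hy : ∀ k, k ≤ n → 0 ≤ y k - y (k+1) := by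
    intro k hk
    rcases k with _ | k
    · rcases Nat.eq_zero_or_pos n with h | h
      · simp [y, h]
      · rw [y0, ys 0 h]; linarith [(hx (σ ⟨0, h⟩)).2]
    · have hk' : k < n := hk
      rw [ys k hk']
      by_cases h : k + 1 < n
      · rw [ys _ h]
        have := hσ (show (⟨k, hk'⟩ : Fin n) ≤ ⟨k+1, h⟩ by simp)
        simp only [Function.comp] at this
        linarith
      · have : y (k+1+1) = 0 := by simp [y, h]
        rw [this]; linarith [(hx (σ ⟨k, hk'⟩)).1]
  have hsum1 : ∑ k ∈ Finset.range (n+1), (y k - y (k+1)) = 1 := by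
    have := abel_aux y (fun _ => 1) n
    simpa [y0, yn] using this
  have hsumx : ∀ i, ∑ k ∈ Finset.range (n+1),
      (y k - y (k+1)) * (if i ∈ S k then (1:ℝ) else 0) = x i := by
    intro i
    rw [abel_aux y (fun k => if i ∈ S k then (1:ℝ) else 0) n, yn,
      Finset.sum_eq_single (σ.symm i : ℕ)]
    · rw [ys _ (σ.symm i).2]; simp [memS]
    · intro b _ hb
      have : (i ∈ S (b+1)) ↔ i ∈ S b := by rw [memS, memS]; omega
      simp [this]
    · intro h; exact absurd (Finset.mem_range.2 (σ.symm i).2) h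
  have hsumg : ∑ k ∈ Finset.range (n+1), (y k - y (k+1)) * g (S k) = ∑ i, v i * x i := by
    rw [abel_aux y (fun k => g (S k)) n, yn, hS0, h0, ← Equiv.sum_comp σ,
      ← Fin.sum_univ_eq_sum_range (fun k => y (k+1) * (g (S (k+1)) - g (S k))) n]
    simp only [mul_zero, zero_mul, sub_zero, zero_add]
    refine Finset.sum_congr rfl fun j _ => ?_
    rw [ys _ j.2]
    simp only [v, Equiv.symm_apply_apply]
    ring
  have hz := hv v hvEP
  let d := z - ∑ i, v i * x i
  have hd : 0 ≤ d := by simp only [d]; linarith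
  have hmem := (convex_convexHull ℝ {p : (Fin n → ℝ) × ℝ | (∀ i : Fin n, p.1 i = 0 ∨ p.1 i = 1) ∧
          g (Finset.univ.filter fun i : Fin n => p.1 i = 1) ≤ p.2}).sum_mem
      (t := Finset.range (n+1)) (w := fun k => y k - y (k+1))
      (z := fun k => ((fun i => if i ∈ S k then (1:ℝ) else 0), g (S k) + d))
      (fun k hk => hy k (by simp at hk; omega)) hsum1
      (fun k _ => subset_convexHull ℝ _ (by
        refine ⟨fun i => ?_, ?_⟩
        · by_cases h : i ∈ S k <;> simp [h]
        · simpa using hd))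
  convert hmem using 1
  refine Prod.ext ?_ ?_
  · funext i
    rw [Prod.fst_sum, Finset.sum_apply]
    refine (hsumx i).symm.trans ?_
    simp
  · rw [Prod.snd_sum]
    simp only [Prod.smul_snd, smul_eq_mul, mul_add, Finset.sum_add_distrib]
    rw [hsumg, ← Finset.sum_mul, hsum1]
    simp [d]


/-- For a submodular `g` with `g(∅) = 0`, the convex hull of the discrete
epigraph `B_g = {(x,z) ∈ {0,1}^N × ℝ : g(x) ≤ z}` equals the set of `(x,z)` with
`0 ≤ x ≤ 1` componentwise and `vᵀx ≤ z` for every `v` in the extended polymatroid `EP_g`. -/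
theorem convexHull_discrete_epigraph
    (n : ℕ) (g : Finset (Fin n) → ℝ)
    (hsub : ∀ (S T : Finset (Fin n)) (i : Fin n), S ⊆ T → i ∉ T →
      g (insert i T) - g T ≤ g (insert i S) - g S)
    (h0 : g ∅ = 0) :
    convexHull ℝ
        {p : (Fin n → ℝ) × ℝ | (∀ i : Fin n, p.1 i = 0 ∨ p.1 i = 1) ∧
          g (Finset.univ.filter fun i : Fin n => p.1 i = 1) ≤ p.2} =
      {p : (Fin n → ℝ) × ℝ | (∀ i : Fin n, 0 ≤ p.1 i ∧ p.1 i ≤ 1) ∧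
        ∀ v : Fin n → ℝ, (∀ S : Finset (Fin n), ∑ i ∈ S, v i ≤ g S) →
          ∑ i : Fin n, v i * p.1 i ≤ p.2} := by
  apply Set.Subset.antisymm
  · apply convexHull_min
    · rintro ⟨x, z⟩ ⟨hx, hz⟩
      simp only at hx hz
      refine ⟨fun i => ?_, fun v hv => ?_⟩
      · rcases hx i with h | h <;> simp [h]
      · refine le_trans (le_of_eq ?_) ((hv _).trans hz)
        rw [Finset.sum_filter]
        refine Finset.sum_congr rfl fun i _ => ?_
        rcases hx i with h | h <;> simp [h]
    · rintro ⟨x, z⟩ ⟨hx, hz⟩ ⟨x', z'⟩ ⟨hx', hz'⟩ a b ha hb hab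
      simp only at hx hz hx' hz'
      refine ⟨fun i => ?_, fun v hv => ?_⟩
      · simp only [Prod.fst_add, Prod.smul_fst, Pi.add_apply, Pi.smul_apply, smul_eq_mul]
        constructor
        · have := mul_nonneg ha (hx i).1
          have := mul_nonneg hb (hx' i).1
          linarith
        · have := mul_le_mul_of_nonneg_left (hx i).2 ha
          have := mul_le_mul_of_nonneg_left (hx' i).2 hb
          linarith
      · have h1 := mul_le_mul_of_nonneg_left (hz v hv) ha
        have h2 := mul_le_mul_of_nonneg_left (hz' v hv) hb
        simp only [Prod.fst_add, Prod.smul_fst, Pi.add_apply, Pi.smul_apply, smul_eq_mul,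
          Prod.snd_add, Prod.smul_snd]
        refine le_trans (le_of_eq ?_) (add_le_add h1 h2)
        rw [Finset.mul_sum, Finset.mul_sum, ← Finset.sum_add_distrib]
        exact Finset.sum_congr rfl fun i _ => by ring
  · rintro ⟨x, z⟩ ⟨hx, hv⟩
    exact hull_aux n g hsub h0 x z hx hv
end

section
/- Let g : 2^N → ℝ be a supermodular set function on a finite ground set N, with difference function ρ_i(S) = g(S ∪ {i}) − g(S). Then for all S, T ⊆ N: g(T) ≥ g(S) − ∑_{i ∈ S \ T} ρ_i(N \ {i}) + ∑_{i ∈ T \ S} ρ_i(S). -/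
/-- Nemhauser–Wolsey bound: for a supermodular `g` with difference function
`ρ_i(S) = g(S ∪ {i}) − g(S)`, for all `S, T ⊆ N`:
`g(T) ≥ g(S) − ∑_{i ∈ S \ T} ρ_i(N \ {i}) + ∑_{i ∈ T \ S} ρ_i(S)`. -/
theorem supermodular_bound_one
    (n : ℕ) (g : Finset (Fin n) → ℝ)
    (hsup : ∀ (S T : Finset (Fin n)) (i : Fin n), S ⊆ T → i ∉ T →
      g (insert i S) - g S ≤ g (insert i T) - g T) :
    ∀ S T : Finset (Fin n),
      g S - (∑ i ∈ S \ T, (g (insert i (Finset.univ \ {i})) - g (Finset.univ \ {i})))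
          + (∑ i ∈ T \ S, (g (insert i S) - g S)) ≤ g T := by
  intro S T
  have h1 : ∀ A : Finset (Fin n), Disjoint A S →
      (∑ i ∈ A, (g (insert i S) - g S)) ≤ g (A ∪ S) - g S := by
    intro A
    induction A using Finset.induction_on with
    | empty => intro _; simp
    | insert a A ha ih =>
      intro hd
      rw [Finset.disjoint_insert_left] at hd
      have h := hsup S (A ∪ S) a Finset.subset_union_right (by simp [ha, hd.1])
      rw [Finset.sum_insert ha, Finset.insert_union]
      linarith [ih hd.2]
  have h2 : ∀ A : Finset (Fin n), Disjoint A T →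
      g (A ∪ T) - g T ≤
        ∑ i ∈ A, (g (insert i (Finset.univ \ {i})) - g (Finset.univ \ {i})) := by
    intro A
    induction A using Finset.induction_on with
    | empty => intro _; simp
    | insert a A ha ih =>
      intro hd
      rw [Finset.disjoint_insert_left] at hd
      have h := hsup (A ∪ T) (Finset.univ \ {a}) a
        (by
          intro x hx
          simp only [Finset.mem_sdiff, Finset.mem_univ, Finset.mem_singleton, true_and]
          rintro rfl
          simp [ha, hd.1] at hx) (by simp)
      rw [Finset.sum_insert ha, Finset.insert_union]
      linarith [ih hd.2]
  have e1 := h1 (T \ S) Finset.sdiff_disjoint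
  have e2 := h2 (S \ T) Finset.sdiff_disjoint
  rw [Finset.sdiff_union_self_eq_union] at e1 e2
  rw [Finset.union_comm] at e1
  linarith
end

section
/- Let g : 2^N → ℝ be a supermodular set function on a finite ground set N, with difference function ρ_i(S) = g(S ∪ {i}) − g(S). Then for all S, T ⊆ N: g(T) ≥ g(S) − ∑_{i ∈ S \ T} ρ_i(S \ {i}) + ∑_{i ∈ T \ S} ρ_i(∅). -/
/-- Nemhauser–Wolsey bound: for a supermodular `g` with difference function
`ρ_i(S) = g(S ∪ {i}) − g(S)`, for all `S, T ⊆ N`: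
`g(T) ≥ g(S) − ∑_{i ∈ S \ T} ρ_i(S \ {i}) + ∑_{i ∈ T \ S} ρ_i(∅)`. -/
theorem supermodular_bound_two
    (n : ℕ) (g : Finset (Fin n) → ℝ)
    (hsup : ∀ (S T : Finset (Fin n)) (i : Fin n), S ⊆ T → i ∉ T →
      g (insert i S) - g S ≤ g (insert i T) - g T) :
    ∀ S T : Finset (Fin n),
      g S - (∑ i ∈ S \ T, (g (insert i (S \ {i})) - g (S \ {i})))
          + (∑ i ∈ T \ S, (g (insert i (∅ : Finset (Fin n))) - g ∅)) ≤ g T := by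
  intro S T
  have h1 : ∀ A D : Finset (Fin n), Disjoint D A →
      g A + ∑ i ∈ D, (g (insert i (∅ : Finset (Fin n))) - g ∅) ≤ g (D ∪ A) := by
    intro A D
    induction D using Finset.induction_on with
    | empty => intro _; simp
    | insert a D ha ih =>
      intro hd
      rw [Finset.disjoint_insert_left] at hd
      have h := ih hd.2
      have h' := hsup ∅ (D ∪ A) a (Finset.empty_subset _) (by simp [ha, hd.1])
      rw [Finset.sum_insert ha, Finset.insert_union]
      linarith
  have h2 : ∀ A D : Finset (Fin n), Disjoint D A → D ∪ A ⊆ S →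
      g (D ∪ A) ≤ g A + ∑ i ∈ D, (g (insert i (S \ {i})) - g (S \ {i})) := by
    intro A D
    induction D using Finset.induction_on with
    | empty => intro _ _; simp
    | insert a D ha ih =>
      intro hd hs
      rw [Finset.disjoint_insert_left] at hd
      rw [Finset.insert_union] at hs
      have h := ih hd.2 ((Finset.subset_insert _ _).trans hs)
      have h' := hsup (D ∪ A) (S \ {a}) a (by
        intro x hx
        rw [Finset.mem_sdiff, Finset.mem_singleton]
        refine ⟨hs (Finset.mem_insert_of_mem hx), ?_⟩
        rintro rfl
        rcases Finset.mem_union.1 hx with h | h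
        · exact ha h
        · exact hd.1 h) (by simp)
      rw [Finset.sum_insert ha, Finset.insert_union]
      linarith
  have e1 : (T \ S) ∪ (S ∩ T) = T := by
    ext x; simp only [Finset.mem_union, Finset.mem_sdiff, Finset.mem_inter]; tauto
  have e2 : (S \ T) ∪ (S ∩ T) = S := by
    ext x; simp only [Finset.mem_union, Finset.mem_sdiff, Finset.mem_inter]; tauto
  have k1 := h1 (S ∩ T) (T \ S) (by
    rw [Finset.disjoint_left]; intro x; simp only [Finset.mem_sdiff, Finset.mem_inter]; tauto)
  have k2 := h2 (S ∩ T) (S \ T) (by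
    rw [Finset.disjoint_left]; intro x; simp only [Finset.mem_sdiff, Finset.mem_inter]; tauto)
    e2.subset
  rw [e1] at k1
  rw [e2] at k2
  linarith
end
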